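/- For every σ > 0 and every α with 0 < α < 1/2, the high-power asymptotics of capacity is: lim_{A → ∞} ( C(A, αA) − log(A/σ) ) = −(1/2)·log(2πe) − (1 − α)·μ* − log(1 − α·μ*), where μ* is the unique positive solution of α = 1/μ* − e^{−μ*}/(1 − e^{−μ*}). -/

import Mathlib

open MeasureTheory ProbabilityTheory Real Filter Set
open scoped Classical Topology

/-- Kullback--Leibler divergence (in nats), valued in the extended reals:
`D(P ∥ R) = ∫ log (dP/dR) dP` if `P ≪ R` and the log-likelihood ratio is
`P`-integrable, and `+∞` otherwise. -/
noncomputable def klDiv {α : Type*} [MeasurableSpace α] (P R : Measure α) : EReal :=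
  if P ≪ R ∧ Integrable (llr P R) P then ((∫ x, llr P R x ∂P : ℝ) : EReal) else ⊤

/-- Joint law of `(X, Y)` where `X ~ Q` and `Y = X + Z` with `Z ~ N(0, σ²)`
independent of `X`. -/
noncomputable def jointLaw (σ : ℝ) (Q : Measure ℝ) : Measure (ℝ × ℝ) :=
  (Q.prod (gaussianReal 0 ⟨σ ^ 2, sq_nonneg σ⟩)).map (fun p => (p.1, p.1 + p.2))

/-- Mutual information `I(X;Y)` in nats: the KL divergence of the joint law of
`(X, Y)` from the product of its marginal laws. -/
noncomputable def mutualInfo (σ : ℝ) (Q : Measure ℝ) : EReal :=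
  klDiv (jointLaw σ Q) (((jointLaw σ Q).map Prod.fst).prod ((jointLaw σ Q).map Prod.snd))

/-- Capacity `C(A, E)` of the channel `Y = X + Z`, `Z ~ N(0, σ²)`, with peak-power
constraint `A` (i.e. `P(0 ≤ X ≤ A) = 1`) and average-power constraint `E[X] ≤ E`:
the supremum of the mutual information over all admissible input laws. -/
noncomputable def capacity (σ A E : ℝ) : EReal :=
  ⨆ Q ∈ {Q : Measure ℝ | IsProbabilityMeasure Q ∧ Q (Set.Icc 0 A) = 1 ∧
      ∫⁻ x, ENNReal.ofReal x ∂Q ≤ ENNReal.ofReal E}, mutualInfo σ Q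

open scoped ENNReal NNReal

noncomputable def outD (v : ℝ≥0) (Q : Measure ℝ) (y : ℝ) : ℝ≥0∞ :=
  ∫⁻ x, gaussianPDF 0 v (y - x) ∂Q

lemma measurable_g (v : ℝ≥0) : Measurable (fun p : ℝ × ℝ => gaussianPDF 0 v (p.2 - p.1)) :=
  (measurable_gaussianPDF 0 v).comp (measurable_snd.sub measurable_fst)

lemma measurable_outD (v : ℝ≥0) (Q : Measure ℝ) [SFinite Q] : Measurable (outD v Q) := by
  unfold outD
  exact (measurable_g v).lintegral_prod_left'

lemma map_joint (v : ℝ≥0) (hv : v ≠ 0) (Q : Measure ℝ) [IsProbabilityMeasure Q] :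
    (Q.prod (gaussianReal 0 v)).map (fun p => (p.1, p.1 + p.2)) =
      (Q.prod volume).withDensity (fun p => gaussianPDF 0 v (p.2 - p.1)) := by
  refine Measure.ext_of_lintegral _ fun h hh => ?_
  have hm : Measurable (fun p : ℝ × ℝ => (p.1, p.1 + p.2)) := by fun_prop
  rw [lintegral_map hh hm, lintegral_withDensity_eq_lintegral_mul _ (measurable_g v) hh,
    lintegral_prod (fun a : ℝ × ℝ => h (a.1, a.1 + a.2)) (hh.comp hm).aemeasurable,
    lintegral_prod _ ((measurable_g v).mul hh).aemeasurable]
  refine lintegral_congr fun x => ?_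
  rw [gaussianReal_of_var_ne_zero _ hv, lintegral_withDensity_eq_lintegral_mul _
    (measurable_gaussianPDF 0 v) (by fun_prop)]
  rw [← lintegral_add_left_eq_self (μ := volume) _ x]
  rw [← lintegral_add_left_eq_self (μ := volume) (fun a => ((fun p : ℝ × ℝ => gaussianPDF 0 v (p.2 - p.1)) * h) (x, a)) x]
  rw [lintegral_add_left_eq_self (μ := volume) _ x]
  simp

lemma map_snd (v : ℝ≥0) (hv : v ≠ 0) (Q : Measure ℝ) [IsProbabilityMeasure Q] :
    (Q.prod (gaussianReal 0 v)).map (fun p => p.1 + p.2) =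
      volume.withDensity (outD v Q) := by
  have : (Q.prod (gaussianReal 0 v)).map (fun p => p.1 + p.2) =
    ((Q.prod (gaussianReal 0 v)).map (fun p => (p.1, p.1 + p.2))).map Prod.snd := by
    rw [Measure.map_map measurable_snd (by fun_prop)]; rfl
  rw [this, map_joint v hv]
  refine Measure.ext_of_lintegral _ fun h hh => ?_
  rw [lintegral_map hh measurable_snd, lintegral_withDensity_eq_lintegral_mul _ (measurable_g v)
    (by fun_prop), lintegral_withDensity_eq_lintegral_mul _ (measurable_outD v Q) hh,
    lintegral_prod_symm _ ((measurable_g v).mul (by fun_prop)).aemeasurable]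
  refine lintegral_congr fun y => ?_
  simp only [Pi.mul_apply, outD]
  exact lintegral_mul_const _ ((measurable_gaussianPDF 0 v).comp (by fun_prop : Measurable fun x : ℝ => y - x))

lemma pdf_le (v : ℝ≥0) (x : ℝ) : gaussianPDFReal 0 v x ≤ (√(2 * π * v))⁻¹ := by
  rw [gaussianPDFReal]
  refine mul_le_of_le_one_right (by positivity) ?_
  rw [Real.exp_le_one_iff]
  exact div_nonpos_of_nonpos_of_nonneg (by nlinarith [sq_nonneg (x-0)]) (by positivity)

lemma outD_le (v : ℝ≥0) (Q : Measure ℝ) [IsProbabilityMeasure Q] (y : ℝ) :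
    outD v Q y ≤ ENNReal.ofReal ((√(2 * π * v))⁻¹) := by
  calc outD v Q y ≤ ∫⁻ x, ENNReal.ofReal ((√(2 * π * v))⁻¹) ∂Q :=
        lintegral_mono fun x => ENNReal.ofReal_le_ofReal (pdf_le v _)
    _ = _ := by simp

lemma outD_ge (v : ℝ≥0) (hv : v ≠ 0) (Q : Measure ℝ) [IsProbabilityMeasure Q] (A : ℝ)
    (hQ : ∀ᵐ x ∂Q, x ∈ Icc 0 A) (y : ℝ) :
    ENNReal.ofReal ((√(2 * π * v))⁻¹ * rexp (-(|y| + A) ^ 2 / (2 * v))) ≤ outD v Q y := by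
  calc _ = ∫⁻ x, ENNReal.ofReal ((√(2 * π * v))⁻¹ * rexp (-(|y| + A) ^ 2 / (2 * v))) ∂Q := by
        simp
    _ ≤ _ := by
        refine lintegral_mono_ae ?_
        filter_upwards [hQ] with x hx
        refine ENNReal.ofReal_le_ofReal ?_
        rw [gaussianPDFReal]
        have h0 : (y - x - 0) ^ 2 ≤ (|y| + A) ^ 2 := by
         rw [sub_zero]
         refine sq_le_sq' ?_ ?_
         · linarith [hx.1, hx.2, neg_abs_le y]
         · linarith [hx.1, hx.2, le_abs_self y]
        gcongr

lemma outD_ne_top (v : ℝ≥0) (Q : Measure ℝ) [IsProbabilityMeasure Q] (y : ℝ) :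
    outD v Q y ≠ ∞ := ((outD_le v Q y).trans_lt ENNReal.ofReal_lt_top).ne

lemma c_pos (v : ℝ≥0) (hv : v ≠ 0) : 0 < (√(2 * π * v))⁻¹ := by
  have : 0 < (v : ℝ) := by exact_mod_cast pos_iff_ne_zero.2 hv
  positivity

lemma outD_pos (v : ℝ≥0) (hv : v ≠ 0) (Q : Measure ℝ) [IsProbabilityMeasure Q] (A : ℝ)
    (hQ : ∀ᵐ x ∂Q, x ∈ Icc 0 A) (y : ℝ) : 0 < outD v Q y := by
  refine lt_of_lt_of_le ?_ (outD_ge v hv Q A hQ y)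
  have := c_pos v hv
  rw [ENNReal.ofReal_pos]; positivity

lemma log_outD_le (v : ℝ≥0) (hv : v ≠ 0) (Q : Measure ℝ) [IsProbabilityMeasure Q] (A : ℝ)
    (hQ : ∀ᵐ x ∂Q, x ∈ Icc 0 A) (y : ℝ) :
    |Real.log (outD v Q y).toReal| ≤ |Real.log ((√(2 * π * v))⁻¹)| + (|y| + A) ^ 2 / (2 * v) := by
  have hc := c_pos v hv
  have h1 : (outD v Q y).toReal ≤ (√(2 * π * v))⁻¹ :=
    ENNReal.toReal_le_of_le_ofReal hc.le (outD_le v Q y)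
  have h2 := outD_ge v hv Q A hQ y
  rw [ENNReal.ofReal_le_iff_le_toReal (outD_ne_top v Q y)] at h2
  have h3 : 0 < (outD v Q y).toReal :=
    ENNReal.toReal_pos (outD_pos v hv Q A hQ y).ne' (outD_ne_top v Q y)
  have h4 := Real.log_le_log h3 h1
  have h5 := Real.log_le_log (by positivity) h2
  rw [Real.log_mul hc.ne' (Real.exp_ne_zero _), Real.log_exp, neg_div] at h5
  have h6 : 0 ≤ (|y| + A) ^ 2 / (2 * v) := by positivity
  rw [abs_le]
  constructor
  · linarith [neg_abs_le (Real.log ((√(2 * π * v))⁻¹))]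
  · linarith [le_abs_self (Real.log ((√(2 * π * v))⁻¹))]

lemma int_sq (v : ℝ≥0) : Integrable (fun z : ℝ => z ^ 2) (gaussianReal 0 v) := by
  have := (memLp_id_gaussianReal (μ := 0) (v := v) 2).integrable_sq
  simpa using this

lemma int_id (v : ℝ≥0) : Integrable (fun z : ℝ => z) (gaussianReal 0 v) := by
  have := (memLp_id_gaussianReal (μ := 0) (v := v) 1)
  rw [ENNReal.coe_one] at this
  exact memLp_one_iff_integrable.1 this

lemma integral_sq (v : ℝ≥0) : ∫ z, z ^ 2 ∂(gaussianReal 0 v) = v := by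
  have := variance_fun_id_gaussianReal (μ := 0) (v := v)
  rw [variance_eq_integral measurable_id'.aemeasurable] at this
  simpa using this

lemma ae_fst {Q N : Measure ℝ} [IsProbabilityMeasure Q] [IsProbabilityMeasure N] {p : ℝ → Prop}
    (h : ∀ᵐ x ∂Q, p x) : ∀ᵐ w ∂(Q.prod N), p w.1 :=
  Measure.quasiMeasurePreserving_fst.ae h

lemma int_log_outD (v : ℝ≥0) (hv : v ≠ 0) (Q : Measure ℝ) [IsProbabilityMeasure Q] (A : ℝ)
    (hQ : ∀ᵐ x ∂Q, x ∈ Icc 0 A) :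
    Integrable (fun p : ℝ × ℝ => Real.log (outD v Q (p.1 + p.2)).toReal)
      (Q.prod (gaussianReal 0 v)) := by
  have hm := measurable_outD v Q
  have hI : Integrable (fun p : ℝ × ℝ => |Real.log ((√(2 * π * v))⁻¹)| +
      (8 * A ^ 2 + 2 * p.2 ^ 2) / (2 * v)) (Q.prod (gaussianReal 0 v)) := by
    refine (integrable_const _).add (((integrable_const _).add ?_).div_const _)
    exact ((int_sq v).comp_snd Q).const_mul 2
  refine hI.mono' ?_ ?_
  · exact (Real.measurable_log.comp (hm.comp (by fun_prop)).ennreal_toReal).aestronglyMeasurable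
  · filter_upwards [ae_fst hQ] with p hp
    refine (log_outD_le v hv Q A hQ _).trans ?_
    gcongr
    have h1 : |p.1 + p.2| ≤ A + |p.2| := (abs_add_le _ _).trans (by
      rw [abs_of_nonneg hp.1]; linarith [hp.2])
    have h2 : (|p.1 + p.2| + A) ^ 2 ≤ (2 * A + |p.2|) ^ 2 := by
      have : 0 ≤ A := hp.1.trans hp.2
      have h3 : |p.1 + p.2| + A ≤ 2 * A + |p.2| := by linarith
      gcongr
    refine h2.trans ?_
    nlinarith [sq_abs p.2, sq_nonneg (2 * A - |p.2|)]

lemma log_pdf (v : ℝ≥0) (hv : v ≠ 0) (z : ℝ) :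
    Real.log (gaussianPDFReal 0 v z) = Real.log ((√(2 * π * v))⁻¹) - z ^ 2 / (2 * v) := by
  rw [gaussianPDFReal, Real.log_mul (c_pos v hv).ne' (Real.exp_ne_zero _), Real.log_exp]
  ring

lemma int_log_pdf (v : ℝ≥0) (hv : v ≠ 0) :
    Integrable (fun z => Real.log (gaussianPDFReal 0 v z)) (gaussianReal 0 v) := by
  simp_rw [log_pdf v hv]
  exact (integrable_const _).sub ((int_sq v).div_const _)

lemma integral_log_pdf (v : ℝ≥0) (hv : v ≠ 0) :
    ∫ z, Real.log (gaussianPDFReal 0 v z) ∂(gaussianReal 0 v) =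
      Real.log ((√(2 * π * v))⁻¹) - 1 / 2 := by
  simp_rw [log_pdf v hv]
  rw [integral_sub (integrable_const _) ((int_sq v).div_const _), integral_div, integral_sq]
  have : (v : ℝ) ≠ 0 := by exact_mod_cast hv
  simp
  field_simp

lemma mutualInfo_eq (σ : ℝ) (v : ℝ≥0) (hvσ : v = ⟨σ ^ 2, sq_nonneg σ⟩) (hv : v ≠ 0)
    (Q : Measure ℝ) [IsProbabilityMeasure Q] (A : ℝ) (hQ : ∀ᵐ x ∂Q, x ∈ Icc 0 A) :
    mutualInfo σ Q = ((Real.log ((√(2 * π * v))⁻¹) - 1 / 2 -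
      ∫ p, Real.log (outD v Q (p.1 + p.2)).toReal ∂(Q.prod (gaussianReal 0 v)) : ℝ) : EReal) := by
  have hT : Measurable (fun p : ℝ × ℝ => (p.1, p.1 + p.2)) := by fun_prop
  have hm := measurable_outD v Q
  set P0 := Q.prod (gaussianReal 0 v) with hP0
  set P := jointLaw σ Q with hP
  have hPd : P = P0.map (fun p => (p.1, p.1 + p.2)) := by rw [hP, jointLaw, ← hvσ]
  have hfst : P.map Prod.fst = Q := by
    rw [hPd, Measure.map_map measurable_fst hT]
    change P0.map Prod.fst = Q
    rw [hP0, Measure.map_fst_prod]; simp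
  have hsnd : P.map Prod.snd = volume.withDensity (outD v Q) := by
    rw [hPd, Measure.map_map measurable_snd hT, ← map_snd v hv]; rfl
  have hPP : IsProbabilityMeasure P := by
    rw [hPd]; exact Measure.isProbabilityMeasure_map hT.aemeasurable
  have hSP : IsProbabilityMeasure (volume.withDensity (outD v Q)) := by
    rw [← hsnd]; exact Measure.isProbabilityMeasure_map measurable_snd.aemeasurable
  set R := Q.prod (volume.withDensity (outD v Q)) with hR
  have hR2 : R = (Q.prod volume).withDensity (fun z => outD v Q z.2) :=
    prod_withDensity_right hm
  set d : ℝ × ℝ → ℝ≥0∞ := fun p => gaussianPDF 0 v (p.2 - p.1) / outD v Q p.2 with hd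
  have hdm : Measurable d := (measurable_g v).div (hm.comp measurable_snd)
  have hPR : P = R.withDensity d := by
    rw [hR2, ← withDensity_mul _ (f := fun z : ℝ × ℝ => outD v Q z.2) (hm.comp measurable_snd) hdm, hPd, map_joint v hv]
    congr 1
    ext p
    simp only [Pi.mul_apply, hd]
    rw [ENNReal.mul_div_cancel (outD_pos v hv Q A hQ _).ne' (outD_ne_top v Q _)]
  have hac : P ≪ R := by rw [hPR]; exact withDensity_absolutelyContinuous _ _
  have hllr : llr P R =ᵐ[P] fun p => Real.log (gaussianPDFReal 0 v (p.2 - p.1)) -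
      Real.log (outD v Q p.2).toReal := by
    have := Measure.rnDeriv_withDensity R hdm
    rw [← hPR] at this
    filter_upwards [hac.ae_eq this] with p hp
    rw [llr, hp, hd, ENNReal.toReal_div, toReal_gaussianPDF, Real.log_div]
    · exact (gaussianPDFReal_pos _ _ _ hv).ne'
    · exact (ENNReal.toReal_pos (outD_pos v hv Q A hQ _).ne' (outD_ne_top v Q _)).ne'
  have hmeas : Measurable (fun p : ℝ × ℝ => Real.log (gaussianPDFReal 0 v (p.2 - p.1)) -
      Real.log (outD v Q p.2).toReal) :=
    (Real.measurable_log.comp ((measurable_gaussianPDFReal 0 v).comp (by fun_prop))).sub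
      (Real.measurable_log.comp (hm.comp (by fun_prop)).ennreal_toReal)
  have hi1 : Integrable (fun p : ℝ × ℝ => Real.log (gaussianPDFReal 0 v p.2)) P0 :=
    (int_log_pdf v hv).comp_snd Q
  have hi2 := int_log_outD v hv Q A hQ
  have hint : Integrable (llr P R) P := by
    rw [integrable_congr hllr, hPd, integrable_map_measure hmeas.aestronglyMeasurable
      hT.aemeasurable]
    refine (hi1.sub hi2).congr (ae_of_all _ fun p => ?_)
    simp
  rw [mutualInfo, hfst, hsnd, klDiv, if_pos ⟨hac, hint⟩, integral_congr_ae hllr, hPd,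
    integral_map hT.aemeasurable hmeas.aestronglyMeasurable]
  simp only [add_sub_cancel_left]
  have h7 : ∫ p, Real.log (gaussianPDFReal 0 v p.2) ∂P0 =
      Real.log ((√(2 * π * v))⁻¹) - 1 / 2 := by
    rw [hP0, integral_fun_snd (fun z => Real.log (gaussianPDFReal 0 v z)), integral_log_pdf v hv]
    simp
  rw [integral_sub hi1 hi2, h7]

lemma integral_exp_abs {k : ℝ} (hk : 0 < k) : ∫ y : ℝ, rexp (-k * |y|) = 2 / k := by
  rw [integral_comp_abs (f := fun x => rexp (-k * x)), integral_exp_mul_Ioi (by linarith)]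
  simp
  field_simp

lemma integrable_exp_abs {k : ℝ} (hk : 0 < k) : Integrable (fun y : ℝ => rexp (-k * |y|)) := by
  by_contra h
  have h1 := integral_exp_abs hk
  rw [integral_undef h] at h1
  have : 0 < 2 / k := by positivity
  linarith

lemma intexp {A b : ℝ} (hA : 0 < A) (hb : 0 < b) :
    ∫ x in Icc 0 A, rexp (-b * x) = (1 - rexp (-b * A)) / b := by
  rw [integral_Icc_eq_integral_Ioc, ← intervalIntegral.integral_of_le hA.le]
  rw [intervalIntegral.integral_eq_sub_of_hasDerivAt (f := fun x => -(rexp (-b * x) / b))]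
  · simp; ring
  · intro x _
    have h1 : HasDerivAt (fun x : ℝ => -b * x) (-b) x := by
      simpa using (hasDerivAt_id x).const_mul (-b)
    have h3 : HasDerivAt (fun x => -(rexp (-b * x) / b)) (-(rexp (-b * x) * -b / b)) x :=
      (h1.exp.div_const b).neg
    have h4 : -(rexp (-b * x) * -b / b) = rexp (-b * x) := by field_simp
    rwa [h4] at h3
  · exact Continuous.intervalIntegrable (by fun_prop) _ _

lemma intxexp {A b : ℝ} (hA : 0 < A) (hb : 0 < b) :
    ∫ x in Icc 0 A, x * rexp (-b * x) = 1 / b ^ 2 - (A / b + 1 / b ^ 2) * rexp (-b * A) := by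
  rw [integral_Icc_eq_integral_Ioc, ← intervalIntegral.integral_of_le hA.le]
  rw [intervalIntegral.integral_eq_sub_of_hasDerivAt
    (f := fun x => -((x / b + 1 / b ^ 2) * rexp (-b * x)))]
  · simp; ring
  · intro x _
    have h1 : HasDerivAt (fun x : ℝ => -b * x) (-b) x := by
      simpa using (hasDerivAt_id x).const_mul (-b)
    have h2 : HasDerivAt (fun x : ℝ => x / b + 1 / b ^ 2) (1 / b) x :=
      ((hasDerivAt_id x).div_const b).add_const _
    have h3 : HasDerivAt (fun x => -((x / b + 1 / b ^ 2) * rexp (-b * x)))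
      (-(1 / b * rexp (-b * x) + (x / b + 1 / b ^ 2) * (rexp (-b * x) * -b))) x :=
      (h2.mul h1.exp).neg
    have h4 : -(1 / b * rexp (-b * x) + (x / b + 1 / b ^ 2) * (rexp (-b * x) * -b)) =
      x * rexp (-b * x) := by field_simp; ring
    rwa [h4] at h3
  · exact Continuous.intervalIntegrable (by fun_prop) _ _

noncomputable def rr (a b k A y : ℝ) : ℝ :=
  a * ((Icc 0 A).indicator (fun y => rexp (-b * y)) y + rexp (-k * |y|) + rexp (-k * |y - A|))

lemma rr_pos {a b k A y : ℝ} (ha : 0 < a) : 0 < rr a b k A y := by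
  unfold rr
  have : 0 ≤ (Icc 0 A).indicator (fun y => rexp (-b * y)) y :=
    indicator_nonneg (fun _ _ => (Real.exp_pos _).le) _
  positivity

lemma rr_ge {a b k A x y : ℝ} (ha : 0 < a) (hb : 0 < b) (hk : 0 < k) (hx : x ∈ Icc 0 A) :
    a * rexp (-(b * x + (b + k) * |y - x|)) ≤ rr a b k A y := by
  unfold rr
  refine mul_le_mul_of_nonneg_left ?_ ha.le
  have h0 : 0 ≤ (Icc 0 A).indicator (fun y => rexp (-b * y)) y :=
    indicator_nonneg (fun _ _ => (Real.exp_pos _).le) _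
  have h1 := Real.exp_pos (-k * |y|)
  have h2 := Real.exp_pos (-k * |y - A|)
  have h3 : 0 ≤ b * |y - x| := by positivity
  have h4 : 0 ≤ k * |y - x| := by positivity
  have h5 : 0 ≤ b * x := mul_nonneg hb.le hx.1
  by_cases hy : y ∈ Icc 0 A
  · have : rexp (-(b * x + (b + k) * |y - x|)) ≤ (Icc 0 A).indicator (fun y => rexp (-b * y)) y := by
      rw [indicator_of_mem hy]
      refine Real.exp_le_exp.2 ?_
      nlinarith [le_abs_self (y - x)]
    linarith
  · by_cases hy0 : y < 0
    · have : rexp (-(b * x + (b + k) * |y - x|)) ≤ rexp (-k * |y|) := by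
        refine Real.exp_le_exp.2 ?_
        have : |y| ≤ |y - x| := by
          rw [abs_of_neg hy0, abs_of_neg (by linarith [hx.1])]; linarith [hx.1]
        nlinarith
      linarith
    · have hyA : A < y := by
        by_contra h; exact hy ⟨not_lt.1 hy0, not_lt.1 h⟩
      have : rexp (-(b * x + (b + k) * |y - x|)) ≤ rexp (-k * |y - A|) := by
        refine Real.exp_le_exp.2 ?_
        have : |y - A| ≤ |y - x| := by
          rw [abs_of_pos (by linarith), abs_of_pos (by linarith [hx.2])]; linarith [hx.2]
        nlinarith
      linarith

lemma integrable_ind (A b : ℝ) : Integrable ((Icc 0 A).indicator (fun y => rexp (-b * y))) :=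
  (integrable_indicator_iff measurableSet_Icc).2
    (Continuous.integrableOn_Icc (by fun_prop))

lemma integrable_rr (a b A : ℝ) {k : ℝ} (hk : 0 < k) : Integrable (rr a b k A) :=
  (((integrable_ind A b).add (integrable_exp_abs hk)).add
    ((integrable_exp_abs hk).comp_sub_right A)).const_mul a

lemma integral_rr {a b A k : ℝ} (hA : 0 < A) (hb : 0 < b) (hk : 0 < k)
    (hn : a * ((1 - rexp (-b * A)) / b) = 1) : ∫ y, rr a b k A y = 1 + 4 * a / k := by
  unfold rr
  have h1 := integrable_ind A b
  have h2 := integrable_exp_abs hk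
  have h3 := (integrable_exp_abs hk).comp_sub_right A
  have h12 : Integrable (fun y => (Icc 0 A).indicator (fun y => rexp (-b * y)) y +
      rexp (-k * |y|)) := h1.add h2
  rw [integral_const_mul, integral_add h12 h3, integral_add h1 h2,
    integral_indicator measurableSet_Icc, intexp hA hb, integral_exp_abs hk,
    integral_sub_right_eq_self (fun y => rexp (-k * |y|)) A, integral_exp_abs hk]
  rw [mul_add, mul_add, hn]
  ring

lemma upper_h (v : ℝ≥0) (hv : v ≠ 0) (Q : Measure ℝ) [IsProbabilityMeasure Q] {A : ℝ}
    (hQ : ∀ᵐ x ∂Q, x ∈ Icc 0 A) {a b k M : ℝ} (hA : 0 < A) (ha : 0 < a) (hb : 0 < b) (hk : 0 < k)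
    (hn : a * ((1 - rexp (-b * A)) / b) = 1) (hM : ∫ x, x ∂Q ≤ M) :
    -∫ p, Real.log (outD v Q (p.1 + p.2)).toReal ∂(Q.prod (gaussianReal 0 v)) ≤
      -Real.log a + b * M + (b + k) * ∫ z, |z| ∂(gaussianReal 0 v) + 4 * a / k := by
  have hm := measurable_outD v Q
  set P0 := Q.prod (gaussianReal 0 v) with hP0
  set G : ℝ → ℝ := fun y => rr a b k A y / (outD v Q y).toReal with hG
  have hFpos : ∀ y, 0 < (outD v Q y).toReal := fun y =>
    ENNReal.toReal_pos (outD_pos v hv Q A hQ y).ne' (outD_ne_top v Q y)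
  have hmr : Measurable (rr a b k A) := by
    unfold rr
    have : Measurable ((Icc 0 A).indicator (fun y => rexp (-b * y))) :=
      Measurable.indicator (by fun_prop) measurableSet_Icc
    fun_prop
  have hGm : Measurable G := hmr.div hm.ennreal_toReal
  have hT : Measurable (fun p : ℝ × ℝ => p.1 + p.2) := by fun_prop
  have hlt : ∀ᵐ y ∂(volume : Measure ℝ), outD v Q y < ∞ :=
    ae_of_all _ fun y => (outD_ne_top v Q y).lt_top
  have hGr : ∀ y, (outD v Q y).toReal • G y = rr a b k A y := fun y => by
    simp only [hG, smul_eq_mul]; rw [mul_div_cancel₀ _ (hFpos y).ne']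
  have hGi : Integrable (fun p : ℝ × ℝ => G (p.1 + p.2)) P0 := by
    have : Integrable G (P0.map (fun p => p.1 + p.2)) := by
      rw [hP0, map_snd v hv, integrable_withDensity_iff_integrable_smul' hm hlt]
      exact (integrable_rr a b A hk).congr (ae_of_all _ fun y => (hGr y).symm)
    exact this.comp_measurable hT
  have hGint : ∫ p, G (p.1 + p.2) ∂P0 = 1 + 4 * a / k := by
    rw [← integral_map (f := G) hT.aemeasurable hGm.aestronglyMeasurable, hP0, map_snd v hv,
      integral_withDensity_eq_integral_toReal_smul hm hlt, ← integral_rr hA hb hk hn]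
    exact integral_congr_ae (ae_of_all _ hGr)
  have hx : Integrable (fun x : ℝ => x) Q := by
    refine Integrable.mono' (integrable_const A) (by fun_prop) ?_
    filter_upwards [hQ] with x hx
    rw [Real.norm_eq_abs, abs_of_nonneg hx.1]; exact hx.2
  have hx' : Integrable (fun p : ℝ × ℝ => p.1) P0 := hx.comp_fst _
  have hz' : Integrable (fun p : ℝ × ℝ => |p.2|) P0 := (int_id v).abs.comp_snd Q
  have hB : Integrable (fun p : ℝ × ℝ => (-Real.log a - 1) + b * p.1 + (b + k) * |p.2| +
      G (p.1 + p.2)) P0 :=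
    (((integrable_const _).add (hx'.const_mul b)).add (hz'.const_mul (b + k))).add hGi
  have key : ∫ p, -Real.log (outD v Q (p.1 + p.2)).toReal ∂P0 ≤
      ∫ p, ((-Real.log a - 1) + b * p.1 + (b + k) * |p.2| + G (p.1 + p.2)) ∂P0 := by
    refine integral_mono_ae (int_log_outD v hv Q A hQ).neg hB ?_
    filter_upwards [ae_fst hQ] with p hp
    have h1 := rr_ge (y := p.1 + p.2) ha hb hk hp
    rw [add_sub_cancel_left] at h1
    have h2 := Real.log_le_log (by positivity) h1
    rw [Real.log_mul ha.ne' (Real.exp_ne_zero _), Real.log_exp] at h2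
    have hr := rr_pos (a := a) (b := b) (k := k) (A := A) (y := p.1 + p.2) ha
    have h3 := Real.log_le_sub_one_of_pos (div_pos hr (hFpos (p.1 + p.2)))
    rw [Real.log_div hr.ne' (hFpos _).ne'] at h3
    simp only [hG]
    linarith
  rw [integral_neg] at key
  refine key.trans ?_
  have i1 : Integrable (fun p : ℝ × ℝ => (-Real.log a - 1) + b * p.1) P0 :=
    (integrable_const _).add (hx'.const_mul b)
  have i2 : Integrable (fun p : ℝ × ℝ => (-Real.log a - 1) + b * p.1 + (b + k) * |p.2|) P0 :=
    i1.add (hz'.const_mul (b + k))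
  rw [integral_add i2 hGi,
    integral_add i1 (hz'.const_mul (b + k)),
    integral_add (integrable_const _) (hx'.const_mul b), integral_const_mul, integral_const_mul,
    hGint, hP0, integral_fun_snd (fun z : ℝ => |z|), integral_fun_fst (fun z : ℝ => z)]
  have := mul_le_mul_of_nonneg_left hM hb.le
  simp
  linarith

noncomputable def qq (a b A : ℝ) : Measure ℝ :=
  (volume.restrict (Icc 0 A)).withDensity (fun x => ENNReal.ofReal (a * rexp (-b * x)))

lemma lint_qq {a b A : ℝ} (ha : 0 < a) (g : ℝ → ℝ) (hg : Continuous g)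
    (hg0 : ∀ x ∈ Icc 0 A, 0 ≤ g x) : ∫⁻ x, ENNReal.ofReal (g x) ∂(qq a b A) =
      ENNReal.ofReal (a * ∫ x in Icc 0 A, g x * rexp (-b * x)) := by
  rw [qq, lintegral_withDensity_eq_lintegral_mul _ (by fun_prop) (by fun_prop),
    ← integral_const_mul, ofReal_integral_eq_lintegral_ofReal]
  · refine lintegral_congr fun x => ?_
    simp only [Pi.mul_apply]
    rw [← ENNReal.ofReal_mul (by positivity)]
    congr 1; ring
  · exact Continuous.integrableOn_Icc (by fun_prop)
  · filter_upwards [ae_restrict_mem measurableSet_Icc] with x hx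
    have := hg0 x hx
    simp only [Pi.zero_apply]
    positivity

lemma qq_prob {a b A : ℝ} (hA : 0 < A) (ha : 0 < a) (hb : 0 < b)
    (hn : a * ((1 - rexp (-b * A)) / b) = 1) : IsProbabilityMeasure (qq a b A) := by
  constructor
  have := lint_qq (a := a) (b := b) (A := A) ha (fun _ => 1) (by fun_prop) (by simp)
  simp only [one_mul, intexp hA hb, hn] at this
  simpa using this

lemma qq_ae (a b A : ℝ) : ∀ᵐ x ∂(qq a b A), x ∈ Icc 0 A :=
  (withDensity_absolutelyContinuous _ _).ae_le (ae_restrict_mem measurableSet_Icc)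

lemma outD_qq_le (v : ℝ≥0) (hv : v ≠ 0) {a b A : ℝ} (ha : 0 < a) (y : ℝ) :
    outD v (qq a b A) y ≤ ENNReal.ofReal (a * rexp (-b * y) * rexp (v * b ^ 2 / 2)) := by
  have hmg : Measurable fun x : ℝ => gaussianPDF 0 v (y - x) :=
    (measurable_gaussianPDF 0 v).comp (by fun_prop)
  have hI := (integrable_exp_mul_gaussianReal (μ := 0) (v := v) b).const_mul (a * rexp (-b * y))
  calc outD v (qq a b A) y
      = ∫⁻ x in Icc 0 A, ENNReal.ofReal (a * rexp (-b * x)) * gaussianPDF 0 v (y - x) := by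
        rw [outD, qq, lintegral_withDensity_eq_lintegral_mul _ (by fun_prop) hmg]; rfl
    _ ≤ ∫⁻ x, ENNReal.ofReal (a * rexp (-b * x)) * gaussianPDF 0 v (y - x) :=
        setLIntegral_le_lintegral _ _
    _ = ∫⁻ z, gaussianPDF 0 v z * ENNReal.ofReal (a * rexp (-b * y) * rexp (b * z)) := by
        rw [← lintegral_sub_left_eq_self (μ := volume) _ y]
        refine lintegral_congr fun z => ?_
        rw [sub_sub_cancel, mul_comm, mul_assoc a, ← Real.exp_add]
        congr 4; ring
    _ = ∫⁻ z, ENNReal.ofReal (a * rexp (-b * y) * rexp (b * z)) ∂(gaussianReal 0 v) := by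
        rw [gaussianReal_of_var_ne_zero _ hv, lintegral_withDensity_eq_lintegral_mul _
          (measurable_gaussianPDF 0 v) (by fun_prop)]; rfl
    _ = ENNReal.ofReal (∫ z, a * rexp (-b * y) * rexp (b * z) ∂(gaussianReal 0 v)) := by
        rw [ofReal_integral_eq_lintegral_ofReal hI]
        exact ae_of_all _ fun z => by simp only [Pi.zero_apply]; positivity
    _ = _ := by
        have h := congrFun (mgf_fun_id_gaussianReal (μ := 0) (v := v)) b
        simp only [mgf] at h
        rw [integral_const_mul, h]; simp

lemma lower_h (v : ℝ≥0) (hv : v ≠ 0) {a b A M : ℝ} (hA : 0 < A) (ha : 0 < a) (hb : 0 < b)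
    (hn : a * ((1 - rexp (-b * A)) / b) = 1) (hM : ∫ x, x ∂(qq a b A) = M) :
    -Real.log a + b * M - v * b ^ 2 / 2 ≤
    -∫ p, Real.log (outD v (qq a b A) (p.1 + p.2)).toReal ∂((qq a b A).prod (gaussianReal 0 v)) := by
  have := qq_prob hA ha hb hn
  have hQ := qq_ae a b A
  set Q := qq a b A with hQd
  have hx : Integrable (fun x : ℝ => x) Q := by
    refine Integrable.mono' (integrable_const A) (by fun_prop) ?_
    filter_upwards [hQ] with x hx
    rw [Real.norm_eq_abs, abs_of_nonneg hx.1]; exact hx.2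
  have hx' : Integrable (fun p : ℝ × ℝ => p.1) (Q.prod (gaussianReal 0 v)) := hx.comp_fst _
  have hz' : Integrable (fun p : ℝ × ℝ => p.2) (Q.prod (gaussianReal 0 v)) := (int_id v).comp_snd Q
  have key : ∫ p, (-Real.log a - v * b ^ 2 / 2 + b * (p.1 + p.2)) ∂(Q.prod (gaussianReal 0 v)) ≤
      ∫ p, -Real.log (outD v Q (p.1 + p.2)).toReal ∂(Q.prod (gaussianReal 0 v)) := by
    refine integral_mono ((integrable_const _).add ((hx'.add hz').const_mul b))
      (int_log_outD v hv Q A hQ).neg ?_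
    intro p
    have h1 := outD_qq_le v hv (a := a) (b := b) (A := A) ha (p.1 + p.2)
    have h2 := ENNReal.toReal_le_of_le_ofReal (by positivity) h1
    have h3 := Real.log_le_log (ENNReal.toReal_pos (outD_pos v hv Q A hQ _).ne'
      (outD_ne_top v Q _)) h2
    rw [Real.log_mul (by positivity) (by positivity), Real.log_mul ha.ne' (by positivity),
      Real.log_exp, Real.log_exp] at h3
    simp only
    linarith
  rw [integral_neg] at key
  refine le_trans (le_of_eq ?_) key
  have i1 : Integrable (fun p : ℝ × ℝ => b * (p.1 + p.2)) (Q.prod (gaussianReal 0 v)) :=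
    (hx'.add hz').const_mul b
  rw [integral_add (integrable_const _) i1, integral_const_mul,
    integral_add hx' hz', integral_fun_snd (fun z : ℝ => z), integral_fun_fst (fun z : ℝ => z), hM,
    integral_id_gaussianReal]
  simp
  ring

/-- High-power asymptotics of `C(A, αA)` for `0 < α < 1/2`, where `μs` is the
unique positive solution of `α = 1/μ − e^{−μ}/(1 − e^{−μ})`. -/
theorem capacity_high_power_asymptotics_strong (σ α μs : ℝ) (hσ : 0 < σ)
    (hα₀ : 0 < α) (hα : α < 1 / 2) (hμs : 0 < μs)
    (hchar : α = 1 / μs - rexp (-μs) / (1 - rexp (-μs))) :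
    Tendsto (fun A : ℝ => capacity σ A (α * A) - ((Real.log (A / σ) : ℝ) : EReal)) atTop
      (𝓝 ((-(1 / 2) * Real.log (2 * π * rexp 1) - (1 - α) * μs
          - Real.log (1 - α * μs) : ℝ) : EReal)) := by
  set v : ℝ≥0 := ⟨σ ^ 2, sq_nonneg σ⟩ with hvd
  have hvR : (v : ℝ) = σ ^ 2 := rfl
  have hv : v ≠ 0 := by
    intro h
    have : (v : ℝ) = 0 := by rw [h]; rfl
    rw [hvR] at this
    exact hσ.ne' (by simpa using this)
  have he : rexp (-μs) < 1 := by rw [Real.exp_lt_one_iff]; linarith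
  have he' : 0 < 1 - rexp (-μs) := by linarith
  set c : ℝ := μs / (1 - rexp (-μs)) with hc
  have hcpos : 0 < c := by positivity
  have hlogc : Real.log (1 - α * μs) = Real.log c - μs := by
    have : 1 - α * μs = c * rexp (-μs) := by
      rw [hchar, hc]; field_simp; ring
    rw [this, Real.log_mul hcpos.ne' (Real.exp_ne_zero _), Real.log_exp]; ring
  set m : ℝ := ∫ z, |z| ∂(gaussianReal 0 v) with hm
  have hK : Real.log ((√(2 * π * v))⁻¹) - 1 / 2 =
      -(1 / 2) * Real.log (2 * π * rexp 1) - Real.log σ := by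
    have h2π : 0 < 2 * π := by positivity
    rw [Real.log_inv, Real.log_sqrt (by positivity), hvR, Real.log_mul h2π.ne' (by positivity),
      Real.log_mul h2π.ne' (by positivity), Real.log_exp, Real.log_pow]
    push_cast; ring
  set T : ℝ := -(1 / 2) * Real.log (2 * π * rexp 1) - (1 - α) * μs - Real.log (1 - α * μs) with hT
  have hnA : ∀ A : ℝ, 0 < A → c / A * ((1 - rexp (-(μs / A) * A)) / (μs / A)) = 1 := by
    intro A hA
    have : -(μs / A) * A = -μs := by field_simp
    rw [this, hc]; field_simp
  have hidl : ∀ A : ℝ, 0 < A → -Real.log (c / A) + (μs / A) * (α * A) +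
      (Real.log ((√(2 * π * v))⁻¹) - 1 / 2) - Real.log (A / σ) = T := by
    intro A hA
    rw [hK, Real.log_div hcpos.ne' hA.ne', Real.log_div hA.ne' hσ.ne', hT, hlogc]
    field_simp; ring
  have hlow : ∀ᶠ A : ℝ in atTop, ((T - σ ^ 2 * (μs / A) ^ 2 / 2 : ℝ) : EReal) ≤
      capacity σ A (α * A) - ((Real.log (A / σ) : ℝ) : EReal) := by
    filter_upwards [eventually_gt_atTop 0] with A hA
    have hb : 0 < μs / A := by positivity
    have ha : 0 < c / A := by positivity
    have hn := hnA A hA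
    have hprob := qq_prob hA ha hb hn
    have hae := qq_ae (c / A) (μs / A) A
    have hl : ∫⁻ x, ENNReal.ofReal x ∂(qq (c / A) (μs / A) A) = ENNReal.ofReal (α * A) := by
      rw [lint_qq ha (fun x => x) (by fun_prop) (fun x hx => hx.1), intxexp hA hb]
      congr 1
      have : -(μs / A) * A = -μs := by field_simp
      rw [this, hchar, hc]; field_simp; ring
    have hM : ∫ x, x ∂(qq (c / A) (μs / A) A) = α * A := by
      rw [integral_eq_lintegral_of_nonneg_ae (by filter_upwards [hae] with x hx using hx.1)
        (by fun_prop), hl, ENNReal.toReal_ofReal (by positivity)]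
    have h1 := lower_h v hv hA ha hb hn hM
    have h2 := mutualInfo_eq σ v hvd hv _ A hae
    have h3 : mutualInfo σ (qq (c / A) (μs / A) A) ≤ capacity σ A (α * A) := by
      unfold capacity
      exact le_iSup₂_of_le (qq (c / A) (μs / A) A)
        ⟨hprob, (prob_compl_eq_zero_iff measurableSet_Icc).1 hae, hl.le⟩ le_rfl
    rw [h2] at h3
    refine le_trans ?_ (EReal.sub_le_sub h3 le_rfl)
    rw [← EReal.coe_sub, EReal.coe_le_coe_iff]
    have := hidl A hA
    rw [hvR] at h1
    linarith
  have hup : ∀ᶠ A : ℝ in atTop, capacity σ A (α * A) - ((Real.log (A / σ) : ℝ) : EReal) ≤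
      ((T + ((μs / A + (√A)⁻¹) * m + 4 * (√A)⁻¹ * c) : ℝ) : EReal) := by
    filter_upwards [eventually_gt_atTop 0] with A hA
    have hb : 0 < μs / A := by positivity
    have ha : 0 < c / A := by positivity
    have hk : 0 < (√A)⁻¹ := by positivity
    have hn := hnA A hA
    have h3 : capacity σ A (α * A) ≤ ((T + ((μs / A + (√A)⁻¹) * m + 4 * (√A)⁻¹ * c) +
        Real.log (A / σ) : ℝ) : EReal) := by
      unfold capacity
      refine iSup₂_le ?_
      rintro Q ⟨hprob, hQ1, hQ2⟩
      have hae : ∀ᵐ x ∂Q, x ∈ Icc 0 A := (prob_compl_eq_zero_iff measurableSet_Icc).2 hQ1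
      have hM : ∫ x, x ∂Q ≤ α * A := by
        rw [integral_eq_lintegral_of_nonneg_ae (by filter_upwards [hae] with x hx using hx.1)
          (by fun_prop)]
        exact ENNReal.toReal_le_of_le_ofReal (by positivity) hQ2
      have h1 := upper_h v hv Q hae hA ha hb hk hn hM
      rw [mutualInfo_eq σ v hvd hv Q A hae, EReal.coe_le_coe_iff]
      have := hidl A hA
      have h5 : 4 * (c / A) / (√A)⁻¹ = 4 * (√A)⁻¹ * c := by
        have : √A ≠ 0 := by positivity
        field_simp
        rw [Real.sq_sqrt hA.le]
      rw [h5] at h1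
      linarith
    refine (EReal.sub_le_sub h3 le_rfl).trans ?_
    rw [← EReal.coe_sub, EReal.coe_le_coe_iff]
    linarith
  have hd : Tendsto (fun A : ℝ => μs / A) atTop (𝓝 0) := tendsto_const_nhds.div_atTop tendsto_id
  have hs : Tendsto (fun A : ℝ => (√A)⁻¹) atTop (𝓝 0) :=
    tendsto_inv_atTop_zero.comp Real.tendsto_sqrt_atTop
  refine tendsto_of_tendsto_of_tendsto_of_le_of_le' ?_ ?_ hlow hup
  · refine (continuous_coe_real_ereal.tendsto T).comp ?_
    have := ((hd.pow 2).const_mul (σ ^ 2)).div_const 2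
    have := (tendsto_const_nhds (x := T)).sub this
    simpa using this
  · refine (continuous_coe_real_ereal.tendsto T).comp ?_
    have := (tendsto_const_nhds (x := T)).add
      (((hd.add hs).mul_const m).add ((hs.const_mul 4).mul_const c))
    simpa using this
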